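/- The q-binomial theorem: for complex numbers q, a, z with |q| < 1 and |z| < 1, the series ∑_{k=0}^∞ ((a;q)_k / (q;q)_k) z^k converges and equals (az;q)_∞ / (z;q)_∞. -/

import Mathlib

/-- The finite `q`-shifted factorial `(a;q)_k`. -/
noncomputable def qPoch (a q : ℂ) (k : ℕ) : ℂ := ∏ j ∈ Finset.range k, (1 - a * q ^ j)

/-- The infinite `q`-shifted factorial `(a;q)_∞`. -/
noncomputable def qPochInf (a q : ℂ) : ℂ := ∏' j : ℕ, (1 - a * q ^ j)

open Filter Topology

lemma qPoch_succ (a q : ℂ) (k : ℕ) : qPoch a q (k + 1) = qPoch a q k * (1 - a * q ^ k) :=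
  Finset.prod_range_succ _ _

lemma summable_norm_neg_mul_pow (a : ℂ) {q : ℂ} (hq : ‖q‖ < 1) :
    Summable fun j : ℕ => ‖-(a * q ^ j)‖ := by
  simpa only [norm_neg, norm_mul, norm_pow] using
    (summable_geometric_of_lt_one (norm_nonneg q) hq).mul_left ‖a‖

lemma tendsto_qPoch (a : ℂ) {q : ℂ} (hq : ‖q‖ < 1) :
    Tendsto (qPoch a q) atTop (𝓝 (qPochInf a q)) := by
  have h := (multipliable_one_add_of_summable
    (summable_norm_neg_mul_pow a hq)).hasProd.tendsto_prod_nat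
  simp only [← sub_eq_add_neg] at h
  exact h

lemma one_sub_ne_zero_of_norm_lt_one {z : ℂ} (hz : ‖z‖ < 1) : 1 - z ≠ 0 := by
  intro h
  rw [← sub_eq_zero.mp h, norm_one] at hz
  exact lt_irrefl _ hz

lemma one_sub_mul_pow_ne_zero {q z : ℂ} (hq : ‖q‖ < 1) (hz : ‖z‖ < 1) (j : ℕ) :
    1 - z * q ^ j ≠ 0 := by
  apply one_sub_ne_zero_of_norm_lt_one
  rw [norm_mul, norm_pow]
  exact (mul_le_of_le_one_right (norm_nonneg z) (pow_le_one₀ (norm_nonneg q) hq.le)).trans_lt hz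

lemma qPochInf_ne_zero {q z : ℂ} (hq : ‖q‖ < 1) (hz : ‖z‖ < 1) : qPochInf z q ≠ 0 := by
  have h := tprod_one_add_ne_zero_of_summable (f := fun j : ℕ => -(z * q ^ j))
    (fun j => by simpa only [← sub_eq_add_neg] using one_sub_mul_pow_ne_zero hq hz j)
    (summable_norm_neg_mul_pow z hq)
  simp only [← sub_eq_add_neg] at h
  exact h

lemma qPoch_div_succ (a q : ℂ) (k : ℕ) :
    qPoch a q (k + 1) / qPoch q q (k + 1) =
      qPoch a q k / qPoch q q k * ((1 - a * q ^ k) / (1 - q * q ^ k)) := by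
  rw [qPoch_succ, qPoch_succ, mul_div_mul_comm]

lemma summable_qPoch_div_mul_pow (a : ℂ) {q z : ℂ} (hq : ‖q‖ < 1) (hz : ‖z‖ < 1) :
    Summable fun k : ℕ => qPoch a q k / qPoch q q k * z ^ k := by
  obtain ⟨r, hzr, hr⟩ := exists_between hz
  have hpow := tendsto_pow_atTop_nhds_zero_of_norm_lt_one hq
  have hlim : Tendsto (fun k : ℕ => ‖(1 - a * q ^ k) / (1 - q * q ^ k) * z‖) atTop (𝓝 ‖z‖) := by
    have h := ((((hpow.const_mul a).const_sub 1).div ((hpow.const_mul q).const_sub 1)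
      (by simp)).mul_const z).norm
    simpa using h
  refine summable_of_ratio_norm_eventually_le hr ?_
  filter_upwards [hlim.eventually_le_const hzr] with k hk
  rw [qPoch_div_succ a q, pow_succ, mul_mul_mul_comm, norm_mul, mul_comm]
  exact mul_le_mul_of_nonneg_right hk (norm_nonneg _)

/-- The functional equation `(1 - w) F(w) = (1 - a w) F(q w)` of the `q`-binomial series `F`. -/
lemma one_sub_mul_tsum_qPoch_div (a : ℂ) {q w : ℂ} (hq : ‖q‖ < 1) (hw : ‖w‖ < 1) :
    (1 - w) * ∑' k : ℕ, qPoch a q k / qPoch q q k * w ^ k =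
      (1 - a * w) * ∑' k : ℕ, qPoch a q k / qPoch q q k * (w * q) ^ k := by
  have hwq : ‖w * q‖ < 1 := by
    rw [norm_mul]
    exact mul_lt_one_of_nonneg_of_lt_one_left (norm_nonneg w) hw hq.le
  have h₁ := summable_qPoch_div_mul_pow a hq hw
  have h₂ := summable_qPoch_div_mul_pow a hq hwq
  have hsub := (h₁.sub h₂).tsum_eq_zero_add
  rw [h₁.tsum_sub h₂] at hsub
  have hterm : ∀ k : ℕ,
      qPoch a q (k + 1) / qPoch q q (k + 1) * w ^ (k + 1) -
        qPoch a q (k + 1) / qPoch q q (k + 1) * (w * q) ^ (k + 1) =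
      w * (qPoch a q k / qPoch q q k * w ^ k) -
        a * w * (qPoch a q k / qPoch q q k * (w * q) ^ k) := by
    intro k
    have h := one_sub_mul_pow_ne_zero hq hq k
    have hdiv : (1 - a * q ^ k) / (1 - q * q ^ k) * (1 - q * q ^ k) = 1 - a * q ^ k :=
      div_mul_cancel₀ _ h
    rw [qPoch_div_succ a q, mul_pow, mul_pow, pow_succ w, pow_succ q]
    linear_combination (qPoch a q k / qPoch q q k * w ^ k * w) * hdiv
  simp only [hterm] at hsub
  rw [(h₁.mul_left w).tsum_sub (h₂.mul_left (a * w)), tsum_mul_left, tsum_mul_left] at hsub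
  simp only [pow_zero, sub_self, zero_add] at hsub
  linear_combination hsub

lemma qPoch_mul_tsum_qPoch_div (a : ℂ) {q z : ℂ} (hq : ‖q‖ < 1) (hz : ‖z‖ < 1) (n : ℕ) :
    qPoch z q n * ∑' k : ℕ, qPoch a q k / qPoch q q k * z ^ k =
      qPoch (a * z) q n * ∑' k : ℕ, qPoch a q k / qPoch q q k * (z * q ^ n) ^ k := by
  induction n with
  | zero => simp [qPoch]
  | succ n ih =>
    have hw : ‖z * q ^ n‖ < 1 := by
      rw [norm_mul, norm_pow]
      exact (mul_le_of_le_one_right (norm_nonneg z)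
        (pow_le_one₀ (norm_nonneg q) hq.le)).trans_lt hz
    have h := one_sub_mul_tsum_qPoch_div a hq hw
    rw [mul_assoc z, ← pow_succ] at h
    rw [qPoch_succ, qPoch_succ]
    linear_combination (1 - z * q ^ n) * ih + qPoch (a * z) q n * h

lemma tendsto_tsum_qPoch_div (a : ℂ) {q z : ℂ} (hq : ‖q‖ < 1) (hz : ‖z‖ < 1) :
    Tendsto (fun n : ℕ => ∑' k : ℕ, qPoch a q k / qPoch q q k * (z * q ^ n) ^ k)
      atTop (𝓝 1) := by
  have hone : ∑' k : ℕ, qPoch a q k / qPoch q q k * (0 : ℂ) ^ k = 1 := by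
    rw [tsum_eq_single 0 fun k hk => by simp [hk]]
    simp [qPoch]
  rw [← hone]
  refine tendsto_tsum_of_dominated_convergence (summable_qPoch_div_mul_pow a hq hz).norm ?_ ?_
  · intro k
    have h := (tendsto_pow_atTop_nhds_zero_of_norm_lt_one hq).const_mul z
    rw [mul_zero] at h
    exact (h.pow k).const_mul _
  · refine Eventually.of_forall fun n k => ?_
    rw [norm_mul, norm_mul, norm_pow, norm_pow, norm_mul, norm_pow]
    gcongr
    exact mul_le_of_le_one_right (norm_nonneg z) (pow_le_one₀ (norm_nonneg q) hq.le)

/-- The `q`-binomial theorem: for `‖q‖ < 1` and `‖z‖ < 1`,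
`∑_{k=0}^∞ ((a;q)_k / (q;q)_k) z^k = (az;q)_∞ / (z;q)_∞`. -/
theorem q_binomial_theorem (q a z : ℂ) (hq : ‖q‖ < 1) (hz : ‖z‖ < 1) :
    HasSum (fun k : ℕ => qPoch a q k / qPoch q q k * z ^ k)
      (qPochInf (a * z) q / qPochInf z q) := by
  have h := tendsto_nhds_unique
    (((tendsto_qPoch z hq).mul_const _).congr (qPoch_mul_tsum_qPoch_div a hq hz))
    ((tendsto_qPoch (a * z) hq).mul (tendsto_tsum_qPoch_div a hq hz))
  rw [mul_one, mul_comm] at h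
  rw [← eq_div_of_mul_eq (qPochInf_ne_zero hq hz) h]
  exact (summable_qPoch_div_mul_pow a hq hz).hasSum
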